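/- Assume q ≠ 0, let V ∈ ℝ^{n×(n−1)} have orthonormal columns spanning {q}^⊥, H_q = VᵀHV, and assume H_q ≠ 0. Let x ∈ Ω and let y = x − ‖H_q‖^{-1}β(x), where ‖H_q‖ is the spectral norm. Then f(y) − f(x) ≤ −(1/2)‖H_q‖^{-1}‖β(x)‖². -/

import Mathlib

noncomputable section

open Matrix
open scoped Classical

/-- Euclidean dot product. -/
def dotp {m : Type*} [Fintype m] (v w : m → ℝ) : ℝ := ∑ i, v i * w i

/-- Euclidean norm. -/
def nrm {m : Type*} [Fintype m] (v : m → ℝ) : ℝ := Real.sqrt (∑ i, (v i) ^ 2)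

/-- Objective f(x) = ½ xᵀHx − cᵀx. -/
def fObj {n : ℕ} (H : Matrix (Fin n) (Fin n) ℝ) (c x : Fin n → ℝ) : ℝ :=
  (1 / 2) * dotp x (H.mulVec x) - dotp c x

/-- Gradient ∇f(x) = Hx − c (for H symmetric). -/
def grad {n : ℕ} (H : Matrix (Fin n) (Fin n) ℝ) (c x : Fin n → ℝ) : Fin n → ℝ :=
  H.mulVec x - c

/-- Feasible set Ω = {x : qᵀx = b, l ≤ x ≤ u}. -/
def OmegaSet {n : ℕ} (q : Fin n → ℝ) (b : ℝ) (l u : Fin n → ℝ) : Set (Fin n → ℝ) :=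
  {x | dotp q x = b ∧ ∀ i, l i ≤ x i ∧ x i ≤ u i}

/-- Lower active set A_l(x). -/
def Al {n : ℕ} (l x : Fin n → ℝ) : Set (Fin n) := {i | x i = l i}

/-- Upper active set A_u(x). -/
def Au {n : ℕ} (u x : Fin n → ℝ) : Set (Fin n) := {i | x i = u i}

/-- Active set A(x). -/
def ASet {n : ℕ} (l u x : Fin n → ℝ) : Set (Fin n) := Al l x ∪ Au u x

/-- Free set F(x). -/
def FSet {n : ℕ} (l u x : Fin n → ℝ) : Set (Fin n) := (ASet l u x)ᶜ

/-- ρ(x) = q_Fᵀ(∇f(x))_F / q_Fᵀq_F (0 if q_F = 0). -/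
def rhoF {n : ℕ} (H : Matrix (Fin n) (Fin n) ℝ) (c q l u x : Fin n → ℝ) : ℝ :=
  if ∀ i ∈ FSet l u x, q i = 0 then 0
  else (∑ i, if i ∈ FSet l u x then q i * grad H c x i else 0) /
    (∑ i, if i ∈ FSet l u x then q i * q i else 0)

/-- h(x) = ∇f(x) − ρ(x) q. -/
def hVec {n : ℕ} (H : Matrix (Fin n) (Fin n) ℝ) (c q l u x : Fin n → ℝ) : Fin n → ℝ :=
  fun i => grad H c x i - rhoF H c q l u x * q i

/-- Free gradient φ(x). -/
def phiVec {n : ℕ} (H : Matrix (Fin n) (Fin n) ℝ) (c q l u x : Fin n → ℝ) : Fin n → ℝ :=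
  fun i => if i ∈ FSet l u x then hVec H c q l u x i else 0

/-- Tangent cone T_Ω(x). -/
def TCone {n : ℕ} (q l u x : Fin n → ℝ) : Set (Fin n → ℝ) :=
  {v | dotp q v = 0 ∧ (∀ i ∈ Al l x, 0 ≤ v i) ∧ (∀ i ∈ Au u x, v i ≤ 0)}

/-- g is the projected gradient ∇_Ω f(x): the minimizer of ‖v + ∇f(x)‖ over v ∈ T_Ω(x). -/
def IsProjGrad {n : ℕ} (H : Matrix (Fin n) (Fin n) ℝ) (c q l u x g : Fin n → ℝ) : Prop :=
  g ∈ TCone q l u x ∧ ∀ v ∈ TCone q l u x, nrm (g + grad H c x) ≤ nrm (v + grad H c x)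

/-- Chopped gradient β(x) = −∇_Ω f(x) − φ(x), where g = ∇_Ω f(x). -/
def betaVec {n : ℕ} (H : Matrix (Fin n) (Fin n) ℝ) (c q l u x g : Fin n → ℝ) : Fin n → ℝ :=
  -g - phiVec H c q l u x

/-- Binding set B(x). -/
def BSet {n : ℕ} (H : Matrix (Fin n) (Fin n) ℝ) (c q l u x : Fin n → ℝ) : Set (Fin n) :=
  {i | (i ∈ Al l x ∧ 0 ≤ hVec H c q l u x i) ∨ (i ∈ Au u x ∧ hVec H c q l u x i ≤ 0)}

/-- Affine closure Ω(x) of the face determined by the active set at x. -/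
def OmegaFace {n : ℕ} (q : Fin n → ℝ) (b : ℝ) (l u x : Fin n → ℝ) : Set (Fin n → ℝ) :=
  {v | dotp q v = b ∧ ∀ i ∈ ASet l u x, v i = x i}

/-- Ω₀(x). -/
def Omega0 {n : ℕ} (q l u x : Fin n → ℝ) : Set (Fin n → ℝ) :=
  {v | dotp q v = 0 ∧ ∀ i ∈ ASet l u x, v i = 0}

/-- KKT stationarity: ∇f(x) = Σ_{i∈A(x)} λᵢ eᵢ + ρ q with sign conditions. -/
def Stationary {n : ℕ} (H : Matrix (Fin n) (Fin n) ℝ) (c q : Fin n → ℝ) (b : ℝ)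
    (l u x : Fin n → ℝ) : Prop :=
  x ∈ OmegaSet q b l u ∧
    ∃ (ρs : ℝ) (lam : Fin n → ℝ),
      (∀ i, grad H c x i = lam i + ρs * q i) ∧
      (∀ i ∈ FSet l u x, lam i = 0) ∧
      (∀ i ∈ Al l x, 0 ≤ lam i) ∧ (∀ i ∈ Au u x, lam i ≤ 0)

/-- Lagrange multiplier estimate λ(x). -/
def lamEst {n : ℕ} (H : Matrix (Fin n) (Fin n) ℝ) (c q l u x : Fin n → ℝ) : Fin n → ℝ :=
  fun i =>
    if i ∈ Al l x then max 0 (hVec H c q l u x i)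
    else if i ∈ Au u x then min 0 (hVec H c q l u x i) else 0

/-- ζ is the smallest eigenvalue of M. -/
def IsSmallestEigenvalue {m : Type*} [Fintype m] (M : Matrix m m ℝ) (ζ : ℝ) : Prop :=
  (∃ v : m → ℝ, v ≠ 0 ∧ M.mulVec v = ζ • v) ∧
    ∀ (μ : ℝ) (v : m → ℝ), v ≠ 0 → M.mulVec v = μ • v → ζ ≤ μ

/-- ζ is the largest eigenvalue of M. -/
def IsLargestEigenvalue {m : Type*} [Fintype m] (M : Matrix m m ℝ) (ζ : ℝ) : Prop :=
  (∃ v : m → ℝ, v ≠ 0 ∧ M.mulVec v = ζ • v) ∧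
    ∀ (μ : ℝ) (v : m → ℝ), v ≠ 0 → M.mulVec v = μ • v → μ ≤ ζ

/-- t is the spectral (ℓ₂ operator) norm of M. -/
def IsSpectralNorm {m k : Type*} [Fintype m] [Fintype k] (M : Matrix m k ℝ) (t : ℝ) : Prop :=
  IsLeast {s : ℝ | 0 ≤ s ∧ ∀ v : k → ℝ, nrm (M.mulVec v) ≤ s * nrm v} t

theorem nrm_sq {m : Type*} [Fintype m] (v : m → ℝ) : nrm v ^ 2 = v ⬝ᵥ v := by
  rw [nrm, Real.sq_sqrt (Finset.sum_nonneg fun i _ => sq_nonneg _)]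
  simp [dotProduct, sq]

theorem nrm_nonneg {m : Type*} [Fintype m] (v : m → ℝ) : 0 ≤ nrm v :=
  Real.sqrt_nonneg _

theorem dotProduct_le_nrm_mul_nrm {m : Type*} [Fintype m] (v w : m → ℝ) :
    v ⬝ᵥ w ≤ nrm v * nrm w :=
  Real.sum_mul_le_sqrt_mul_sqrt _ v w

/-- A quadratic form is bounded by the spectral norm of its matrix. -/
theorem IsSpectralNorm.dotProduct_mulVec_le {m : Type*} [Fintype m] {M : Matrix m m ℝ} {t : ℝ}
    (h : IsSpectralNorm M t) (w : m → ℝ) : w ⬝ᵥ M *ᵥ w ≤ t * (w ⬝ᵥ w) :=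
  calc w ⬝ᵥ M *ᵥ w ≤ nrm w * nrm (M *ᵥ w) := dotProduct_le_nrm_mul_nrm _ _
    _ ≤ nrm w * (t * nrm w) := mul_le_mul_of_nonneg_left (h.1.2 w) (nrm_nonneg w)
    _ = t * (w ⬝ᵥ w) := by rw [← nrm_sq]; ring

/-- Orthonormal columns orthogonal to `q`, one fewer than the dimension, span the orthogonal
complement of `q`. -/
theorem mulVec_transpose_mulVec_eq_self {n : ℕ} (hn : 1 ≤ n) {q : Fin n → ℝ} (hq : q ≠ 0)
    {V : Matrix (Fin n) (Fin (n - 1)) ℝ} (hV : Vᵀ * V = 1) (hVq : q ᵥ* V = 0)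
    {d : Fin n → ℝ} (hd : q ⬝ᵥ d = 0) : V *ᵥ (Vᵀ *ᵥ d) = d := by
  have hqq : q ⬝ᵥ q ≠ 0 := fun h => hq (dotProduct_self_eq_zero.mp h)
  have hVq' : Vᵀ *ᵥ q = 0 := by rw [mulVec_transpose, hVq]
  let A := fromCols V (replicateCol Unit q)
  let B := fromRows Vᵀ (replicateRow Unit ((q ⬝ᵥ q)⁻¹ • q))
  have hBA : B * A = 1 := by
    rw [fromRows_mul_fromCols, hV, ← fromBlocks_one]
    congr 1
    · ext i j
      simpa [mul_apply, mulVec, dotProduct] using congrFun hVq' i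
    · ext i j
      have := congrFun hVq j
      simp only [vecMul, dotProduct, Pi.zero_apply] at this
      simp [mul_apply, mul_assoc, ← Finset.mul_sum, this]
    · ext i j
      simp only [mul_apply, replicateRow_apply, replicateCol_apply, Pi.smul_apply, smul_eq_mul,
        mul_assoc, ← Finset.mul_sum]
      simpa [dotProduct] using inv_mul_cancel₀ hqq
  have e : Fin (n - 1) ⊕ Unit ≃ Fin n :=
    Fintype.equivOfCardEq (by simp; omega)
  have hAB : A * B = 1 := (mul_eq_one_comm_of_equiv e).mp hBA
  rw [fromCols_mul_fromRows] at hAB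
  have h := congrArg (· *ᵥ d) hAB
  simp only [add_mulVec, ← mulVec_mulVec, one_mulVec] at h
  have h0 : replicateRow Unit ((q ⬝ᵥ q)⁻¹ • q) *ᵥ d = 0 := by
    ext i
    change ((q ⬝ᵥ q)⁻¹ • q) ⬝ᵥ d = 0
    rw [smul_dotProduct, hd, smul_zero]
  rwa [h0, mulVec_zero, add_zero] at h

/-- On the orthogonal complement of `q`, the curvature of `H` is at most the spectral norm of the
reduced matrix. -/
theorem dotProduct_mulVec_le_of_orthogonal {n : ℕ} (hn : 1 ≤ n) (H : Matrix (Fin n) (Fin n) ℝ)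
    {q : Fin n → ℝ} (hq : q ≠ 0)
    {V : Matrix (Fin n) (Fin (n - 1)) ℝ} (hV : Vᵀ * V = 1) (hVq : q ᵥ* V = 0) {t : ℝ}
    (ht : IsSpectralNorm (Vᵀ * H * V) t) {d : Fin n → ℝ} (hd : q ⬝ᵥ d = 0) :
    d ⬝ᵥ H *ᵥ d ≤ t * (d ⬝ᵥ d) := by
  obtain ⟨w, rfl⟩ : ∃ w, d = V *ᵥ w := ⟨_, (mulVec_transpose_mulVec_eq_self hn hq hV hVq hd).symm⟩
  have key (z : Fin n → ℝ) : (V *ᵥ w) ⬝ᵥ z = w ⬝ᵥ Vᵀ *ᵥ z := by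
    rw [← vecMul_transpose, ← dotProduct_mulVec]
  rw [key, key, mulVec_mulVec, mulVec_mulVec, mulVec_mulVec, hV, one_mulVec]
  exact ht.dotProduct_mulVec_le w

theorem eq_zero_of_forall_quadratic_nonneg {a b : ℝ}
    (h : ∀ s : ℝ, -1 ≤ s → s ≤ 1 → 0 ≤ 2 * s * a + s ^ 2 * b) : a = 0 := by
  have hc : 0 < |a| + |b| + 1 := by positivity
  have hs : |a / (|a| + |b| + 1)| ≤ 1 := by
    rw [abs_div, abs_of_pos hc, div_le_one hc]
    linarith [abs_nonneg b]
  have h1 := h (-(a / (|a| + |b| + 1))) (by linarith [(abs_le.mp hs).2])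
    (by linarith [(abs_le.mp hs).1])
  set c := |a| + |b| + 1 with hcdef
  have h2 : 2 * -(a / c) * a + (-(a / c)) ^ 2 * b = -(a ^ 2 * (2 * c - b)) / c ^ 2 := by
    field_simp
    ring
  rw [h2] at h1
  have h3 : 0 ≤ -(a ^ 2 * (2 * c - b)) := by
    by_contra! hneg
    linarith [div_neg_of_neg_of_pos hneg (pow_pos hc 2)]
  have h4 : 0 < 2 * c - b := by linarith [le_abs_self b, abs_nonneg a, abs_nonneg b]
  have h5 : a ^ 2 ≤ 0 := by
    by_contra! hpos
    linarith [mul_pos hpos h4]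
  exact pow_eq_zero_iff two_ne_zero |>.mp (le_antisymm h5 (sq_nonneg a))

/-- First-order optimality of the projected gradient along a two-sided feasible direction. -/
theorem IsProjGrad.dotProduct_eq_zero {n : ℕ} {H : Matrix (Fin n) (Fin n) ℝ}
    {c q l u x g v : Fin n → ℝ} (hg : IsProjGrad H c q l u x g)
    (hv : ∀ s : ℝ, -1 ≤ s → s ≤ 1 → g + s • v ∈ TCone q l u x) :
    (g + grad H c x) ⬝ᵥ v = 0 := by
  refine eq_zero_of_forall_quadratic_nonneg (b := v ⬝ᵥ v) fun s h1 h2 => ?_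
  have h := pow_le_pow_left₀ (nrm_nonneg _) (hg.2 _ (hv s h1 h2)) 2
  rw [nrm_sq, nrm_sq, add_right_comm] at h
  simp only [add_dotProduct, dotProduct_add, smul_dotProduct, dotProduct_smul, smul_eq_mul,
    dotProduct_comm v] at h ⊢
  nlinarith [h]

theorem dotProduct_phiVec {n : ℕ} (H : Matrix (Fin n) (Fin n) ℝ) (c q l u x : Fin n → ℝ) :
    q ⬝ᵥ phiVec H c q l u x = 0 := by
  have hsum : q ⬝ᵥ phiVec H c q l u x =
      (∑ i, if i ∈ FSet l u x then q i * grad H c x i else 0) -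
        rhoF H c q l u x * ∑ i, if i ∈ FSet l u x then q i * q i else 0 := by
    rw [Finset.mul_sum, ← Finset.sum_sub_distrib]
    refine Finset.sum_congr rfl fun i _ => ?_
    simp only [phiVec, hVec]
    split_ifs <;> ring
  rw [hsum, rhoF]
  split_ifs with h
  · rw [zero_mul, sub_zero]
    refine Finset.sum_eq_zero fun i _ => ?_
    split_ifs with hi
    · rw [h i hi, zero_mul]
    · rfl
  · have hpos : (∑ i, if i ∈ FSet l u x then q i * q i else 0) ≠ 0 := by
      push Not at h
      obtain ⟨i, hi, hqi⟩ := h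
      refine (Finset.sum_pos' (fun j _ => ?_) ⟨i, Finset.mem_univ i, ?_⟩).ne'
      · split_ifs
        exacts [mul_self_nonneg _, le_rfl]
      · rw [if_pos hi]
        exact mul_self_pos.mpr hqi
    rw [div_mul_cancel₀ _ hpos, sub_self]

theorem phiVec_eq_zero {n : ℕ} (H : Matrix (Fin n) (Fin n) ℝ) (c q l u x : Fin n → ℝ)
    {i : Fin n} (hi : i ∈ ASet l u x) : phiVec H c q l u x i = 0 :=
  if_neg fun h => h hi

theorem grad_dotProduct_phiVec {n : ℕ} (H : Matrix (Fin n) (Fin n) ℝ) (c q l u x : Fin n → ℝ) :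
    grad H c x ⬝ᵥ phiVec H c q l u x = phiVec H c q l u x ⬝ᵥ phiVec H c q l u x := by
  have h : (grad H c x - rhoF H c q l u x • q) ⬝ᵥ phiVec H c q l u x =
      phiVec H c q l u x ⬝ᵥ phiVec H c q l u x := by
    refine Finset.sum_congr rfl fun i _ => ?_
    by_cases hi : i ∈ FSet l u x <;> simp [phiVec, hVec, hi]
  rwa [sub_dotProduct, smul_dotProduct, dotProduct_phiVec, smul_zero, sub_zero] at h

/-- The chopped gradient satisfies `∇f(x)ᵀβ(x) = ‖β(x)‖²`. -/
theorem IsProjGrad.grad_dotProduct_betaVec {n : ℕ} {H : Matrix (Fin n) (Fin n) ℝ}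
    {c q l u x g : Fin n → ℝ} (hg : IsProjGrad H c q l u x g) :
    grad H c x ⬝ᵥ betaVec H c q l u x g = betaVec H c q l u x g ⬝ᵥ betaVec H c q l u x g := by
  obtain ⟨hgq, hgl, hgu⟩ := hg.1
  change q ⬝ᵥ g = 0 at hgq
  have hself := hg.dotProduct_eq_zero (v := g) fun s h1 _ => by
    refine ⟨?_, fun i hi => ?_, fun i hi => ?_⟩
    · change q ⬝ᵥ (g + s • g) = 0
      simp [dotProduct_add, hgq]
    · have := hgl i hi
      simp only [Pi.add_apply, Pi.smul_apply, smul_eq_mul]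
      nlinarith
    · have := hgu i hi
      simp only [Pi.add_apply, Pi.smul_apply, smul_eq_mul]
      nlinarith
  have hphi := hg.dotProduct_eq_zero (v := phiVec H c q l u x) fun s _ _ => by
    refine ⟨?_, fun i hi => ?_, fun i hi => ?_⟩
    · change q ⬝ᵥ (g + s • phiVec H c q l u x) = 0
      simp [dotProduct_add, hgq, dotProduct_phiVec]
    · simpa [phiVec_eq_zero H c q l u x (Or.inl hi)] using hgl i hi
    · simpa [phiVec_eq_zero H c q l u x (Or.inr hi)] using hgu i hi
  have hh := grad_dotProduct_phiVec H c q l u x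
  simp only [betaVec, sub_dotProduct, dotProduct_sub, neg_dotProduct, dotProduct_neg,
    add_dotProduct, dotProduct_comm (phiVec H c q l u x) g] at hself hphi ⊢
  linarith

theorem IsProjGrad.dotProduct_betaVec {n : ℕ} {H : Matrix (Fin n) (Fin n) ℝ}
    {c q l u x g : Fin n → ℝ} (hg : IsProjGrad H c q l u x g) :
    q ⬝ᵥ betaVec H c q l u x g = 0 := by
  have hgq : q ⬝ᵥ g = 0 := hg.1.1
  simp [betaVec, dotProduct_sub, hgq, dotProduct_phiVec]

/-- Exact second-order expansion of the quadratic objective. -/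
theorem fObj_sub_smul {n : ℕ} {H : Matrix (Fin n) (Fin n) ℝ} (hH : H.IsSymm)
    (c x d : Fin n → ℝ) (t : ℝ) :
    fObj H c (x - t • d) - fObj H c x =
      -(t * (grad H c x ⬝ᵥ d)) + (1 / 2) * t ^ 2 * (d ⬝ᵥ H *ᵥ d) := by
  have hsymm : x ⬝ᵥ H *ᵥ d = d ⬝ᵥ H *ᵥ x := by
    rw [dotProduct_mulVec, ← mulVec_transpose, hH.eq, dotProduct_comm]
  change (1 / 2) * ((x - t • d) ⬝ᵥ H *ᵥ (x - t • d)) - c ⬝ᵥ (x - t • d) -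
    ((1 / 2) * (x ⬝ᵥ H *ᵥ x) - c ⬝ᵥ x) = _
  simp only [grad, mulVec_sub, mulVec_smul, sub_dotProduct, dotProduct_sub, smul_dotProduct,
    dotProduct_smul, smul_eq_mul, hsymm, dotProduct_comm (H *ᵥ x) d]
  ring

/-- with y = x − ‖H_q‖⁻¹ β(x), f(y) − f(x) ≤ −½‖H_q‖⁻¹‖β(x)‖². -/
theorem stmt_14 {n : ℕ} (hn : 2 ≤ n)
    (H : Matrix (Fin n) (Fin n) ℝ) (hH : H.IsSymm)
    (c q l u : Fin n → ℝ) (b : ℝ) (hlu : ∀ i, l i < u i) (hq : q ≠ 0)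
    (V : Matrix (Fin n) (Fin (n - 1)) ℝ)
    (hVorth : Vᵀ * V = 1) (hVq : Matrix.vecMul q V = 0)
    (hHqne : Vᵀ * H * V ≠ 0)
    -- nH is the spectral norm ‖H_q‖
    (nH : ℝ) (hnH : IsSpectralNorm (Vᵀ * H * V) nH)
    (x : Fin n → ℝ) (hx : x ∈ OmegaSet q b l u)
    (gP : Fin n → ℝ) (hgP : IsProjGrad H c q l u x gP)
    (y : Fin n → ℝ) (hy : y = x - nH⁻¹ • betaVec H c q l u x gP) :
    fObj H c y - fObj H c x ≤ -((1 / 2) * nH⁻¹ * nrm (betaVec H c q l u x gP) ^ 2) := by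
  have hnH0 : 0 ≤ nH⁻¹ := inv_nonneg.mpr hnH.1.1
  have hcurv := dotProduct_mulVec_le_of_orthogonal (by omega) H hq hVorth hVq hnH
    hgP.dotProduct_betaVec
  have hsq : nH⁻¹ ^ 2 * nH = nH⁻¹ := by
    rcases eq_or_ne nH 0 with h | h
    · simp [h]
    · field_simp
  rw [hy, fObj_sub_smul hH, hgP.grad_dotProduct_betaVec, nrm_sq]
  have h := mul_le_mul_of_nonneg_left hcurv (sq_nonneg nH⁻¹)
  rw [← mul_assoc, hsq] at h
  linarith
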